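/- Let d be a prime, q = d², and let W be a probability distribution on 𝔽_q with Σ_{e∈𝔽_q} √(W(e)·W(e−x)) > 0 for every x ∈ 𝔽_q; define the W-weight |x|_W = −log_d Σ_{e∈𝔽_q} √(W(e)·W(e−x)) and, for R ∈ [0,1), E_x(R,W) = min over probability distributions P on 𝔽_q with H(P) ≥ 1 − R of [Σ_{x∈𝔽_q} P(x)|x|_W − (R + H(P) − 1)], where H(P) = −Σ P(x) log_d P(x). Then for every R ∈ [0,1) and every ε > 0, for all sufficiently large n there exist an additive code C ⊆ 𝔽_q^n with C^⊥ ⊆ C and |C| = q^k where k = ⌈n(1+R)/2⌉, and a set E ⊆ 𝔽_q^n containing from each coset of C in 𝔽_q^n exactly one element of maximal W^n-probability, such that Σ_{e ∈ 𝔽_q^n \ E} W^n(e) ≤ d^{−n(E_x(R,W) − ε)}. -/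

import Mathlib

/-!
STATEMENT 7: the expurgation exponent `E_x(R,W)` is achievable: for every rate
`R ∈ [0,1)` and `ε > 0`, for all large `n` there is a self-orthogonal-containing
additive code `C ⊆ 𝔽_qⁿ` of size `q^⌈n(1+R)/2⌉` and a set `E` of maximum-probability
coset leaders with `∑_{e ∉ E} Wⁿ(e) ≤ d^{−n(E_x(R,W) − ε)}`.
-/

open scoped BigOperators Classical

/-- The standard symplectic form on `(𝔽_d × 𝔽_d)ⁿ`:
`(x,y) = ∑ᵢ (xᵢ yᵢ' − xᵢ' yᵢ)`. -/
def sympForm {d n : ℕ} (x y : Fin n → ZMod d × ZMod d) : ZMod d :=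
  ∑ i, ((x i).1 * (y i).2 - (x i).2 * (y i).1)

/-- The `W`-weight `|x|_W = −log_d ∑_e √(W(e)W(e−x))`. -/
noncomputable def wWeight (d : ℕ) [Fact d.Prime] (W : ZMod d × ZMod d → ℝ)
    (x : ZMod d × ZMod d) : ℝ :=
  -Real.logb d (∑ e, Real.sqrt (W e * W (e - x)))

/-- Base-`d` entropy of a distribution on `𝔽_q = 𝔽_d × 𝔽_d`. -/
noncomputable def entD (d : ℕ) [Fact d.Prime] (P : ZMod d × ZMod d → ℝ) : ℝ :=
  -∑ x, P x * Real.logb d (P x)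

/-- The expurgation exponent
`E_x(R,W) = min_{P : H(P) ≥ 1−R} [∑_x P(x)|x|_W − (R + H(P) − 1)]`. -/
noncomputable def Ex (d : ℕ) [Fact d.Prime] (R : ℝ) (W : ZMod d × ZMod d → ℝ) : ℝ :=
  sInf {v : ℝ | ∃ P : ZMod d × ZMod d → ℝ,
    (∀ x, 0 ≤ P x) ∧ (∑ x, P x) = 1 ∧ 1 - R ≤ entD d P ∧
    v = (∑ x, P x * wWeight d W x) - (R + entD d P - 1)}

section SymplecticForm

variable {d n : ℕ}

/-- The symplectic form as a bilinear map. -/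
def sympBilin (d n : ℕ) :
    (Fin n → ZMod d × ZMod d) →ₗ[ZMod d] (Fin n → ZMod d × ZMod d) →ₗ[ZMod d] ZMod d :=
  LinearMap.mk₂ (ZMod d) sympForm
    (fun x y z => by
      simp only [sympForm, Pi.add_apply, Prod.fst_add, Prod.snd_add, ← Finset.sum_add_distrib]
      exact Finset.sum_congr rfl fun i _ => by ring)
    (fun c x y => by
      simp only [sympForm, Pi.smul_apply, Prod.smul_fst, Prod.smul_snd, smul_eq_mul,
        Finset.mul_sum]
      exact Finset.sum_congr rfl fun i _ => by ring)
    (fun x y z => by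
      simp only [sympForm, Pi.add_apply, Prod.fst_add, Prod.snd_add, ← Finset.sum_add_distrib]
      exact Finset.sum_congr rfl fun i _ => by ring)
    (fun c x y => by
      simp only [sympForm, Pi.smul_apply, Prod.smul_fst, Prod.smul_snd, smul_eq_mul,
        Finset.mul_sum]
      exact Finset.sum_congr rfl fun i _ => by ring)

@[simp] lemma sympBilin_apply (x y : Fin n → ZMod d × ZMod d) :
    sympBilin d n x y = sympForm x y := rfl

lemma sympForm_self (x : Fin n → ZMod d × ZMod d) : sympForm x x = 0 :=
  Finset.sum_eq_zero fun i _ => by ring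

lemma sympForm_swap (x y : Fin n → ZMod d × ZMod d) : sympForm y x = -sympForm x y := by
  simp only [sympForm, ← Finset.sum_neg_distrib]
  exact Finset.sum_congr rfl fun i _ => by ring

lemma sympForm_single_left (i : Fin n) (a : ZMod d × ZMod d) (y : Fin n → ZMod d × ZMod d) :
    sympForm (Pi.single i a) y = a.1 * (y i).2 - a.2 * (y i).1 := by
  unfold sympForm
  rw [Finset.sum_eq_single i]
  · simp
  · intro j _ hj
    simp [hj]
  · simp

lemma exists_sympForm_ne_zero {x : Fin n → ZMod d × ZMod d} (hx : x ≠ 0) :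
    ∃ z, sympForm x z ≠ 0 := by
  by_contra! h
  apply hx
  funext i
  have h1 := h (Pi.single i (1, 0))
  have h2 := h (Pi.single i (0, 1))
  rw [sympForm_swap, sympForm_single_left] at h1 h2
  ext <;> simp_all

lemma exists_sympForm_ne_zero_and {x y : Fin n → ZMod d × ZMod d} (hx : x ≠ 0) (hy : y ≠ 0) :
    ∃ z, sympForm x z ≠ 0 ∧ sympForm z y ≠ 0 := by
  obtain ⟨u, hu⟩ := exists_sympForm_ne_zero hx
  obtain ⟨v, hv'⟩ := exists_sympForm_ne_zero hy
  have hv : sympForm v y ≠ 0 := by rw [sympForm_swap]; simpa using hv'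
  by_cases h1 : sympForm u y = 0
  · by_cases h2 : sympForm x v = 0
    · refine ⟨u + v, ?_, ?_⟩
      · have := map_add (sympBilin d n x) u v
        simp only [sympBilin_apply] at this
        simpa [this, h2] using hu
      · have := LinearMap.map_add₂ (sympBilin d n) u v y
        simp only [sympBilin_apply] at this
        simpa [this, h1] using hv
    · exact ⟨v, h2, hv⟩
  · exact ⟨u, hu, h1⟩

/-- A symplectic transvection carries `x` to `y` when they are not orthogonal. -/
lemma exists_symplectic_of_sympForm_ne_zero [Fact d.Prime] {x y : Fin n → ZMod d × ZMod d}
    (h : sympForm x y ≠ 0) :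
    ∃ g : (Fin n → ZMod d × ZMod d) →+ (Fin n → ZMod d × ZMod d),
      (∀ u v, sympForm (g u) (g v) = sympForm u v) ∧ g x = y := by
  let g : (Fin n → ZMod d × ZMod d) →ₗ[ZMod d] (Fin n → ZMod d × ZMod d) :=
    LinearMap.id + (sympForm x y)⁻¹ • ((sympBilin d n).flip (y - x)).smulRight (y - x)
  have hg (u) : g u = u + ((sympForm x y)⁻¹ * sympForm u (y - x)) • (y - x) := by
    simp [g, mul_smul, -map_sub]
  refine ⟨g.toAddMonoidHom, fun u v => ?_, ?_⟩
  · have key : sympBilin d n (g u) (g v) = sympBilin d n u v := by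
      rw [hg, hg]
      simp only [map_add, LinearMap.add_apply, map_smul, LinearMap.smul_apply, smul_eq_mul]
      simp only [sympBilin_apply, sympForm_self, sympForm_swap (y - x) v]
      rw [sympForm_swap v (y - x)]
      ring
    exact key
  · have hxy : sympForm x (y - x) = sympForm x y := by
      have := map_sub (sympBilin d n x) y x
      simpa [sympForm_self] using this
    change g x = y
    rw [hg, hxy, inv_mul_cancel₀ h]
    simp

/-- The symplectic group is transitive on nonzero vectors. -/
lemma exists_symplectic [Fact d.Prime] {x y : Fin n → ZMod d × ZMod d} (hx : x ≠ 0)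
    (hy : y ≠ 0) :
    ∃ g : (Fin n → ZMod d × ZMod d) →+ (Fin n → ZMod d × ZMod d),
      (∀ u v, sympForm (g u) (g v) = sympForm u v) ∧ g x = y := by
  obtain ⟨z, hxz, hzy⟩ := exists_sympForm_ne_zero_and hx hy
  obtain ⟨g, hg, hgx⟩ := exists_symplectic_of_sympForm_ne_zero hxz
  obtain ⟨k, hk, hkz⟩ := exists_symplectic_of_sympForm_ne_zero hzy
  exact ⟨k.comp g, fun u v => by simp [hk, hg], by simp [hgx, hkz]⟩

lemma injective_of_symplectic {g : (Fin n → ZMod d × ZMod d) →+ (Fin n → ZMod d × ZMod d)}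
    (hg : ∀ u v, sympForm (g u) (g v) = sympForm u v) : Function.Injective g := by
  rw [injective_iff_map_eq_zero]
  intro u hu
  by_contra h
  obtain ⟨z, hz⟩ := exists_sympForm_ne_zero h
  apply hz
  rw [← hg, hu]
  simp [sympForm]

end SymplecticForm

section DualContaining

variable {d n : ℕ} [Fact d.Prime]

/-- The additive codes of size `N` that contain their symplectic dual. -/
noncomputable def dualContainingCodes (d n : ℕ) [Fact d.Prime] (N : ℕ) :
    Finset (AddSubgroup (Fin n → ZMod d × ZMod d)) :=
  Finset.univ.filter fun C => Nat.card C = N ∧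
    ∀ y : Fin n → ZMod d × ZMod d, (∀ x ∈ C, sympForm x y = 0) → y ∈ C

lemma mem_dualContainingCodes {N : ℕ} {C : AddSubgroup (Fin n → ZMod d × ZMod d)} :
    C ∈ dualContainingCodes d n N ↔ Nat.card C = N ∧
      ∀ y : Fin n → ZMod d × ZMod d, (∀ x ∈ C, sympForm x y = 0) → y ∈ C := by
  simp [dualContainingCodes]

lemma dualContainingCodes_nonempty {k : ℕ} (hkn : k ≤ n) (hnk : n ≤ 2 * k) :
    (dualContainingCodes d n ((d ^ 2) ^ k)).Nonempty := by
  let m := 2 * n - 2 * k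
  let C : AddSubgroup (Fin n → ZMod d × ZMod d) :=
    { carrier := {x | ∀ i : Fin n, (i : ℕ) < m → (x i).2 = 0}
      add_mem' := fun {a b} ha hb i hi => by simp [ha i hi, hb i hi]
      zero_mem' := fun i _ => rfl
      neg_mem' := fun {a} ha i hi => by simp [ha i hi] }
  have memC (x) : x ∈ C ↔ ∀ i : Fin n, (i : ℕ) < m → (x i).2 = 0 := Iff.rfl
  refine ⟨C, mem_dualContainingCodes.2 ⟨?_, fun y hy i hi => ?_⟩⟩
  · let s : Fin n → Finset (ZMod d × ZMod d) := fun i =>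
      if (i : ℕ) < m then Finset.univ ×ˢ {0} else Finset.univ
    have hs : (C : Set (Fin n → ZMod d × ZMod d)) = ↑(Fintype.piFinset s) := by
      ext x
      simp only [SetLike.mem_coe, memC, Fintype.mem_piFinset, s]
      refine forall_congr' fun i => ?_
      split_ifs with h
      · simp only [h, true_imp_iff, Finset.mem_product, Finset.mem_univ, Finset.mem_singleton,
          true_and]
      · simp [h]
    have hcard : Nat.card C = (Fintype.piFinset s).card := by
      change Nat.card (C : Set (Fin n → ZMod d × ZMod d)) = _
      rw [hs, Nat.card_coe_set_eq, Set.ncard_coe_finset]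
    have hsc (i) : (s i).card = if (i : ℕ) < m then d else d ^ 2 := by
      simp only [s]
      split_ifs <;> simp [ZMod.card, sq]
    have h1 : (Finset.univ.filter fun i : Fin n => (i : ℕ) < m).card = m := by
      rw [Fin.card_filter_val_lt]
      omega
    have h2 : (Finset.univ.filter fun i : Fin n => ¬ (i : ℕ) < m).card = n - m := by
      have := Finset.card_filter_add_card_filter_not (s := (Finset.univ : Finset (Fin n)))
        (fun i : Fin n => (i : ℕ) < m)
      rw [h1] at this
      simp only [Finset.card_univ, Fintype.card_fin] at this
      omega
    rw [hcard, Fintype.card_piFinset]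
    simp only [hsc]
    rw [Finset.prod_ite, Finset.prod_const, Finset.prod_const, h1, h2, ← pow_mul, ← pow_add,
      ← pow_mul]
    congr 1
    omega
  · have := hy (Pi.single i (1, 0)) fun j hj => by
      by_cases h : j = i
      · subst h; simp
      · simp [h]
    simpa [sympForm_single_left] using this

lemma card_dualContainingCodes_mem_le (N : ℕ) {x y : Fin n → ZMod d × ZMod d} (hx : x ≠ 0)
    (hy : y ≠ 0) :
    ((dualContainingCodes d n N).filter (x ∈ ·)).card ≤
      ((dualContainingCodes d n N).filter (y ∈ ·)).card := by
  obtain ⟨g, hg, hgx⟩ := exists_symplectic hx hy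
  have hinj := injective_of_symplectic hg
  have hsurj : Function.Surjective g := Finite.injective_iff_surjective.1 hinj
  refine Finset.card_le_card_of_injOn (fun C => C.map g) (fun C hC => ?_)
    (AddSubgroup.map_injective hinj).injOn
  simp only [Finset.coe_filter, Set.mem_ofPred_eq, mem_dualContainingCodes] at hC ⊢
  obtain ⟨⟨hC1, hC2⟩, hxC⟩ := hC
  refine ⟨⟨?_, fun v hv => ?_⟩, ⟨x, hxC, hgx⟩⟩
  · rw [← hC1]
    exact (Nat.card_congr (C.equivMapOfInjective g hinj).toEquiv).symm
  · obtain ⟨u, rfl⟩ := hsurj v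
    refine ⟨u, hC2 u fun w hw => ?_, rfl⟩
    rw [← hg]
    exact hv _ ⟨w, hw, rfl⟩

/-- A nonzero vector lies in at most a fraction `N / |V|` of the dual-containing codes. -/
lemma card_dualContainingCodes_mem_mul_le {N : ℕ} {x : Fin n → ZMod d × ZMod d} (hx : x ≠ 0) :
    ((dualContainingCodes d n N).filter (x ∈ ·)).card * d ^ (2 * n) ≤
      (dualContainingCodes d n N).card * N := by
  set F := dualContainingCodes d n N with hF
  set A := (F.filter (x ∈ ·)).card with hA
  have hcard : Fintype.card (Fin n → ZMod d × ZMod d) = d ^ (2 * n) := by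
    simp [ZMod.card, ← sq, ← pow_mul]
  have hC (C) (h : C ∈ F) : (Finset.univ.filter (· ∈ C)).card = N := by
    rw [← (mem_dualContainingCodes.1 h).1, Nat.card_eq_fintype_card, Fintype.card_subtype]
  have hdouble : ∑ y : Fin n → ZMod d × ZMod d, (F.filter (y ∈ ·)).card = F.card * N := by
    simp only [Finset.card_filter]
    rw [Finset.sum_comm]
    simp only [← Finset.card_filter]
    rw [Finset.sum_congr rfl hC]
    simp
  rw [← hdouble, ← hcard, mul_comm, ← smul_eq_mul, ← Finset.card_univ, ← Finset.sum_const]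
  refine Finset.sum_le_sum fun y _ => ?_
  by_cases hy : y = 0
  · subst hy
    refine Finset.card_le_card fun C hCm => ?_
    simp only [Finset.mem_filter] at hCm ⊢
    exact ⟨hCm.1, C.zero_mem⟩
  · exact card_dualContainingCodes_mem_le N hx hy

/-- Averaging over the dual-containing codes. -/
lemma exists_dualContaining_sum_le {k : ℕ} (hkn : k ≤ n) (hnk : n ≤ 2 * k)
    (f : (Fin n → ZMod d × ZMod d) → ℝ) (hf : ∀ x, 0 ≤ f x) :
    ∃ C ∈ dualContainingCodes d n ((d ^ 2) ^ k),
      (∑ x with x ∈ C ∧ x ≠ 0, f x) * (d : ℝ) ^ (2 * n) ≤ (d : ℝ) ^ (2 * k) * ∑ x, f x := by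
  set F := dualContainingCodes d n ((d ^ 2) ^ k) with hF
  refine Finset.exists_le_of_sum_le (dualContainingCodes_nonempty hkn hnk) ?_
  rw [Finset.sum_const, nsmul_eq_mul, ← Finset.sum_mul]
  simp only [Finset.sum_filter]
  rw [Finset.sum_comm, Finset.sum_mul, Finset.mul_sum, Finset.mul_sum]
  refine Finset.sum_le_sum fun x _ => ?_
  by_cases hx : x = 0
  · simp only [hx, ne_eq, not_true_eq_false, and_false, if_false, Finset.sum_const_zero, zero_mul]
    have := hf 0
    positivity
  · have key := card_dualContainingCodes_mem_mul_le (N := (d ^ 2) ^ k) hx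
    rw [← hF, ← pow_mul] at key
    have key' : ((F.filter (x ∈ ·)).card : ℝ) * (d : ℝ) ^ (2 * n) ≤ F.card * (d : ℝ) ^ (2 * k) := by
      exact_mod_cast key
    simp only [ne_eq, hx, not_false_eq_true, and_true]
    rw [← Finset.sum_filter, Finset.sum_const, nsmul_eq_mul]
    nlinarith [mul_le_mul_of_nonneg_right key' (hf x)]

end DualContaining

section Empirical

variable {α : Type*} {n : ℕ}

/-- The empirical distribution of a word. -/
noncomputable def empDist (x : Fin n → α) (a : α) : ℝ :=
  (Finset.univ.filter fun i => x i = a).card / n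

lemma empDist_nonneg (x : Fin n → α) (a : α) : 0 ≤ empDist x a := by
  unfold empDist; positivity

lemma empDist_pos (x : Fin n → α) (i : Fin n) : 0 < empDist x (x i) := by
  have h1 : 0 < (Finset.univ.filter fun j => x j = x i).card :=
    Finset.card_pos.2 ⟨i, by simp⟩
  have h2 : 0 < n := i.pos
  unfold empDist; positivity

variable [Fintype α]

lemma sum_apply_eq_empDist (hn : 0 < n) (x : Fin n → α) (f : α → ℝ) :
    ∑ i, f (x i) = n * ∑ a, empDist x a * f a := by
  have hn' : (n : ℝ) ≠ 0 := by positivity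
  rw [Finset.mul_sum, ← Finset.sum_fiberwise (s := Finset.univ) (g := x)]
  refine Finset.sum_congr rfl fun a _ => ?_
  rw [Finset.sum_congr rfl (g := fun _ => f a)
    (fun i hi => by rw [(Finset.mem_filter.1 hi).2]), Finset.sum_const, nsmul_eq_mul, empDist]
  field_simp

lemma sum_empDist (hn : 0 < n) (x : Fin n → α) : ∑ a, empDist x a = 1 := by
  have h := sum_apply_eq_empDist hn x fun _ => 1
  have hn' : (n : ℝ) ≠ 0 := by positivity
  simp only [Finset.sum_const, Finset.card_univ, Fintype.card_fin, nsmul_eq_mul, mul_one] at h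
  exact mul_left_cancel₀ hn' (by linarith)

/-- The probabilities of the words under their own empirical distributions sum to at most the
number of types. -/
lemma sum_prod_empDist_le (hn : 0 < n) :
    ∑ x : Fin n → α, ∏ i, empDist x (x i) ≤ ((n : ℝ) + 1) ^ Fintype.card α := by
  let cnt : (Fin n → α) → α → ℕ := fun x a => (Finset.univ.filter fun i => x i = a).card
  let T := Finset.univ.image cnt
  have hT : (T.card : ℝ) ≤ ((n : ℝ) + 1) ^ Fintype.card α := by
    have h1 : T ⊆ Fintype.piFinset fun _ => Finset.range (n + 1) := by
      intro t ht
      obtain ⟨x, -, rfl⟩ := Finset.mem_image.1 ht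
      refine Fintype.mem_piFinset.2 fun a => Finset.mem_range_succ_iff.2 ?_
      exact (Finset.card_le_univ _).trans (by simp)
    have h2 := Finset.card_le_card h1
    rw [Fintype.card_piFinset, Finset.prod_const, Finset.card_range, Finset.card_univ] at h2
    exact_mod_cast h2
  refine le_trans ?_ hT
  rw [← Finset.sum_fiberwise_of_maps_to (t := T) (g := cnt)
    (fun x _ => Finset.mem_image_of_mem _ (Finset.mem_univ x)), Finset.card_eq_sum_ones,
    Nat.cast_sum]
  refine Finset.sum_le_sum fun t ht => ?_
  obtain ⟨z, -, hz⟩ := Finset.mem_image.1 ht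
  calc ∑ x with cnt x = t, ∏ i, empDist x (x i)
      = ∑ x with cnt x = t, ∏ i, empDist z (x i) := by
        refine Finset.sum_congr rfl fun x hx => Finset.prod_congr rfl fun i _ => ?_
        have : cnt x = cnt z := by rw [(Finset.mem_filter.1 hx).2, hz]
        have h := congrFun this (x i)
        simp only [cnt] at h
        rw [empDist, empDist, h]
    _ ≤ ∑ x : Fin n → α, ∏ i, empDist z (x i) :=
        Finset.sum_le_sum_of_subset_of_nonneg (Finset.filter_subset _ _)
          fun x _ _ => Finset.prod_nonneg fun i _ => empDist_nonneg z _
    _ = ∏ _i : Fin n, ∑ a, empDist z a := by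
        rw [Finset.prod_univ_sum, Fintype.piFinset_univ]
    _ = ((1 : ℕ) : ℝ) := by simp [sum_empDist hn]

end Empirical

section Entropy

variable {d : ℕ} [Fact d.Prime]

lemma one_lt_prime_cast : (1 : ℝ) < d := by
  exact_mod_cast (Fact.out : d.Prime).one_lt

lemma entD_eq_sum_negMulLog (P : ZMod d × ZMod d → ℝ) :
    entD d P = (∑ x, Real.negMulLog (P x)) / Real.log d := by
  rw [entD, Finset.sum_div, ← Finset.sum_neg_distrib]
  refine Finset.sum_congr rfl fun x _ => ?_
  rw [Real.negMulLog, Real.logb]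
  ring

lemma entD_le {P : ZMod d × ZMod d → ℝ} (hP : ∀ x, 0 ≤ P x) :
    entD d P ≤ (d : ℝ) ^ 2 / Real.log d := by
  have hlog : 0 < Real.log d := Real.log_pos one_lt_prime_cast
  rw [entD_eq_sum_negMulLog]
  gcongr
  have h (x) : Real.negMulLog (P x) ≤ 1 := by
    rcases (hP x).eq_or_lt with h0 | h0
    · simp [← h0]
    · have h1 := Real.one_sub_inv_le_log_of_pos h0
      have h2 := mul_le_mul_of_nonneg_left h1 (hP x)
      rw [mul_sub, mul_inv_cancel₀ h0.ne'] at h2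
      rw [Real.negMulLog]
      linarith
  calc ∑ x, Real.negMulLog (P x) ≤ ∑ _x : ZMod d × ZMod d, (1 : ℝ) :=
        Finset.sum_le_sum fun x _ => h x
    _ = (d : ℝ) ^ 2 := by simp [ZMod.card, sq]

lemma entD_uniform : entD d (fun _ => ((d : ℝ) ^ 2)⁻¹) = 2 := by
  have hd : (1 : ℝ) < d := one_lt_prime_cast
  have hd0 : (d : ℝ) ≠ 0 := by positivity
  have hlog : 0 < Real.log d := Real.log_pos hd
  simp only [entD, Finset.sum_const, Finset.card_univ, Fintype.card_prod, ZMod.card, nsmul_eq_mul,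
    Real.logb, Real.log_inv, Real.log_pow]
  push_cast
  field_simp

lemma entD_mix_le {P Q : ZMod d × ZMod d → ℝ} (hP : ∀ x, 0 ≤ P x) (hQ : ∀ x, 0 ≤ Q x) {t : ℝ}
    (ht0 : 0 ≤ t) (ht1 : t ≤ 1) :
    (1 - t) * entD d P + t * entD d Q ≤ entD d fun x => (1 - t) * P x + t * Q x := by
  have hlog : 0 < Real.log d := Real.log_pos one_lt_prime_cast
  simp only [entD_eq_sum_negMulLog]
  rw [← mul_div_assoc, ← mul_div_assoc, ← add_div, Finset.mul_sum, Finset.mul_sum,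
    ← Finset.sum_add_distrib]
  gcongr with x
  exact Real.concaveOn_negMulLog.2 (hP x) (hQ x) (by linarith) ht0 (by ring)

/-- The exponent is nearly a lower bound under a slightly relaxed entropy constraint. -/
lemma exists_slack_Ex (W : ZMod d × ZMod d → ℝ) {R : ℝ} (hR : 0 ≤ R) {η : ℝ} (hη : 0 < η) :
    ∃ δ : ℝ, 0 < δ ∧ δ ≤ η ∧ ∀ P : ZMod d × ZMod d → ℝ, (∀ x, 0 ≤ P x) → ∑ x, P x = 1 →
      1 - R - δ ≤ entD d P →
      Ex d R W - η ≤ (∑ x, P x * wWeight d W x) - (R + entD d P - 1) := by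
  set w := wWeight d W with hw
  set M := ∑ x, |w x| with hM
  set B := (d : ℝ) ^ 2 / Real.log d with hB
  have hd : (1 : ℝ) < d := one_lt_prime_cast
  have hlog : 0 < Real.log d := Real.log_pos hd
  have hM0 : 0 ≤ M := Finset.sum_nonneg fun x _ => abs_nonneg _
  have hB0 : 0 ≤ B := by positivity
  have habs {P : ZMod d × ZMod d → ℝ} (hP : ∀ x, 0 ≤ P x) (hP1 : ∑ x, P x = 1) :
      |∑ x, P x * w x| ≤ M := by
    refine (Finset.abs_sum_le_sum_abs _ _).trans (Finset.sum_le_sum fun x _ => ?_)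
    rw [abs_mul, abs_of_nonneg (hP x)]
    have : P x ≤ 1 := hP1 ▸ Finset.single_le_sum (fun y _ => hP y) (Finset.mem_univ x)
    exact mul_le_of_le_one_left (abs_nonneg _) this
  set K := 2 * M + B + 1 with hK
  have hK0 : 0 < K := by positivity
  refine ⟨min (min 1 η) (η / K), by positivity,
    (min_le_left _ _).trans (min_le_right _ _), fun P hP hP1 hPH => ?_⟩
  set δ := min (min 1 η) (η / K) with hδ
  have hδ0 : 0 < δ := by positivity
  have hδ1 : δ ≤ 1 := (min_le_left _ _).trans (min_le_left _ _)
  have hδK : δ * K ≤ η := by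
    rw [← le_div_iff₀ hK0]
    exact min_le_right _ _
  let U : ZMod d × ZMod d → ℝ := fun _ => ((d : ℝ) ^ 2)⁻¹
  have hU (x) : 0 ≤ U x := by positivity
  have hU1 : ∑ x, U x = 1 := by
    simp only [U, Finset.sum_const, Finset.card_univ, Fintype.card_prod, ZMod.card, nsmul_eq_mul]
    push_cast
    field_simp
  have hmix := entD_mix_le hP hU hδ0.le hδ1
  rw [show entD d U = 2 from entD_uniform] at hmix
  set P' : ZMod d × ZMod d → ℝ := fun x => (1 - δ) * P x + δ * U x with hP'
  have hP'w : ∑ x, P' x * w x = (1 - δ) * ∑ x, P x * w x + δ * ∑ x, U x * w x := by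
    rw [Finset.mul_sum, Finset.mul_sum, ← Finset.sum_add_distrib]
    exact Finset.sum_congr rfl fun x _ => by rw [hP']; ring
  have hEx : Ex d R W ≤ (∑ x, P' x * w x) - (R + entD d P' - 1) := by
    refine csInf_le ⟨-M - (R + B - 1), ?_⟩ ⟨P', fun x => ?_, ?_, ?_, rfl⟩
    · rintro v ⟨Q, hQ, hQ1, -, rfl⟩
      have h1 := (abs_le.1 (habs hQ hQ1)).1
      have h2 := entD_le hQ
      linarith
    · exact add_nonneg (mul_nonneg (by linarith) (hP x)) (mul_nonneg hδ0.le (hU x))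
    · simp only [hP', Finset.sum_add_distrib, ← Finset.mul_sum, hP1, hU1]
      ring
    · nlinarith [mul_le_mul_of_nonneg_left hPH (by linarith : 0 ≤ 1 - δ),
        mul_nonneg hδ0.le hR, sq_nonneg δ]
  have h1 := (abs_le.1 (habs hP hP1)).1
  have h2 := (abs_le.1 (habs hU hU1)).2
  have h3 := entD_le hP
  have h4 : δ * ((∑ x, U x * w x) - 2 - (∑ x, P x * w x) + entD d P) ≤ δ * K :=
    mul_le_mul_of_nonneg_left (by linarith) hδ0.le
  linarith

lemma prod_empDist_eq_rpow {n : ℕ} (hn : 0 < n) (x : Fin n → ZMod d × ZMod d) :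
    ∏ i, empDist x (x i) = (d : ℝ) ^ (-(n * entD d (empDist x))) := by
  have hd : (1 : ℝ) < d := one_lt_prime_cast
  have h := sum_apply_eq_empDist hn x fun a => Real.logb d (empDist x a)
  rw [entD, mul_neg, neg_neg, ← h, Real.rpow_sum_of_pos (by positivity)]
  exact Finset.prod_congr rfl fun i _ =>
    (Real.rpow_logb (by positivity) hd.ne' (empDist_pos x i)).symm

end Entropy

section Decoding

/-- Every subgroup of a finite group has a transversal maximizing a given real function on each
coset. -/
lemma exists_max_transversal {V : Type*} [AddCommGroup V] [Fintype V] (C : AddSubgroup V)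
    (f : V → ℝ) :
    ∃ E : Finset V, (∀ y, ∃! e, e ∈ E ∧ y - e ∈ C) ∧ ∀ e ∈ E, ∀ y, y - e ∈ C → f y ≤ f e := by
  have hmax (c : V ⧸ C) : ∃ e : V, (e : V ⧸ C) = c ∧ ∀ y : V, (y : V ⧸ C) = c → f y ≤ f e := by
    obtain ⟨e, he, hmax⟩ := Finset.exists_max_image
      (Finset.univ.filter fun y : V => (y : V ⧸ C) = c) f
      (by obtain ⟨y, rfl⟩ := QuotientAddGroup.mk_surjective c; exact ⟨y, by simp⟩)
    exact ⟨e, (Finset.mem_filter.1 he).2, fun y hy => hmax y (by simp [hy])⟩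
  have hmem (y e : V) : y - e ∈ C ↔ (y : V ⧸ C) = e := by
    rw [eq_comm, QuotientAddGroup.eq, neg_add_eq_sub]
  choose lead hlead hle using hmax
  refine ⟨Finset.univ.image lead, fun y => ⟨lead y, ⟨by simp, ?_⟩, ?_⟩, ?_⟩
  · rw [hmem, hlead]
  · rintro e ⟨he, hye⟩
    obtain ⟨c, -, rfl⟩ := Finset.mem_image.1 he
    rw [hmem, hlead] at hye
    rw [hye]
  · intro e he y hye
    obtain ⟨c, -, rfl⟩ := Finset.mem_image.1 he
    rw [hmem, hlead] at hye
    exact hle c y hye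

/-- The Bhattacharyya union bound for maximum-probability coset leaders. -/
lemma sum_not_mem_transversal_le {V : Type*} [AddCommGroup V] [Fintype V] (C : AddSubgroup V)
    {f : V → ℝ} (hf : ∀ x, 0 ≤ f x) {E : Finset V} [DecidablePred (· ∉ E)]
    [DecidablePred fun x => x ∈ C ∧ x ≠ 0] (hE : ∀ y, ∃! e, e ∈ E ∧ y - e ∈ C)
    (hmax : ∀ e ∈ E, ∀ y, y - e ∈ C → f y ≤ f e) :
    ∑ e with e ∉ E, f e ≤ ∑ x with x ∈ C ∧ x ≠ 0, ∑ e, √(f e * f (e - x)) := by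
  rw [Finset.sum_comm]
  refine (Finset.sum_le_sum fun e he => ?_).trans
    (Finset.sum_le_sum_of_subset_of_nonneg (Finset.filter_subset _ _)
      fun e _ _ => Finset.sum_nonneg fun x _ => Real.sqrt_nonneg _)
  have heE := (Finset.mem_filter.1 he).2
  obtain ⟨l, ⟨hl, hel⟩, -⟩ := hE e
  have hne : e - l ≠ 0 := fun h => heE (sub_eq_zero.1 h ▸ hl)
  refine le_trans ?_ (Finset.single_le_sum (f := fun x => √(f e * f (e - x)))
    (fun x _ => Real.sqrt_nonneg _) (Finset.mem_filter.2 ⟨Finset.mem_univ (e - l), hel, hne⟩))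
  refine Real.le_sqrt_of_sq_le ?_
  rw [sub_sub_cancel, sq]
  exact mul_le_mul_of_nonneg_left (hmax l hl e hel) (hf e)

lemma sum_sqrt_prod_eq_rpow {d n : ℕ} [Fact d.Prime] (hn : 0 < n) {W : ZMod d × ZMod d → ℝ}
    (hW0 : ∀ x, 0 ≤ W x) (hBpos : ∀ x : ZMod d × ZMod d, 0 < ∑ e, √(W e * W (e - x)))
    (x : Fin n → ZMod d × ZMod d) :
    ∑ e : Fin n → ZMod d × ZMod d, √((∏ i, W (e i)) * ∏ i, W ((e - x) i)) =
      (d : ℝ) ^ (-(n * ∑ a, empDist x a * wWeight d W a)) := by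
  have hd : (1 : ℝ) < d := one_lt_prime_cast
  rw [← sum_apply_eq_empDist hn, ← Finset.sum_neg_distrib, Real.rpow_sum_of_pos (by positivity)]
  have h (i) : (d : ℝ) ^ (-wWeight d W (x i)) = ∑ a, √(W a * W (a - x i)) := by
    rw [wWeight, neg_neg, Real.rpow_logb (by positivity) hd.ne' (hBpos _)]
  rw [Finset.prod_congr rfl fun i _ => h i, Finset.prod_univ_sum, Fintype.piFinset_univ]
  refine Finset.sum_congr rfl fun e _ => ?_
  rw [← Finset.prod_mul_distrib, Real.sqrt_eq_rpow,
    ← Real.finsetProd_rpow _ _ fun i _ => mul_nonneg (hW0 _) (hW0 _)]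
  simp [Real.sqrt_eq_rpow]

end Decoding

/-- Polynomial factors are eventually dominated by `d ^ (δ n)`. -/
lemma eventually_poly_le_rpow {d : ℝ} (hd : 1 < d) (q : ℕ) {δ : ℝ} (hδ : 0 < δ) :
    ∃ n₀ : ℕ, ∀ n : ℕ, n₀ ≤ n → d ^ 2 * ((n : ℝ) + 1) ^ q ≤ d ^ (δ * n) := by
  have hr : 1 < d ^ δ := Real.one_lt_rpow hd hδ
  have ht := tendsto_pow_const_div_const_pow_of_one_lt q hr
  have ht' := ((Filter.tendsto_add_atTop_iff_nat 1).2 ht).const_mul (d ^ 2 * d ^ δ)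
  rw [mul_zero] at ht'
  obtain ⟨n₀, h⟩ := Filter.eventually_atTop.1 (ht'.eventually_le_const one_pos)
  refine ⟨n₀, fun n hn => ?_⟩
  have := h n hn
  have hpos : 0 < d ^ δ := by positivity
  rw [← mul_div_assoc, div_le_one (by positivity), pow_succ (d ^ δ) n] at this
  rw [Real.rpow_mul (by positivity), Real.rpow_natCast]
  push_cast at this
  refine le_of_mul_le_mul_right ?_ hpos
  linarith

/-- Some dual-containing code of the prescribed size has few words of each type. -/
lemma exists_dualContaining_entropy_sum_le {d n : ℕ} [Fact d.Prime] (hn1 : 0 < n) {R δ : ℝ}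
    (hR0 : 0 ≤ R) (hR1 : R < 1)
    (hpoly : (d : ℝ) ^ 2 * ((n : ℝ) + 1) ^ d ^ 2 ≤ (d : ℝ) ^ (δ * n)) :
    ∃ C ∈ dualContainingCodes d n ((d ^ 2) ^ ⌈(n : ℝ) * (1 + R) / 2⌉₊),
      ∑ x with x ∈ C ∧ x ≠ 0, (d : ℝ) ^ (-(n * entD d (empDist x))) ≤
        (d : ℝ) ^ (n * (R - 1 + δ)) := by
  have hd : (1 : ℝ) < d := one_lt_prime_cast
  have hd0 : (0 : ℝ) < d := by positivity
  have hn1' : (0 : ℝ) < n := by exact_mod_cast hn1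
  set k := ⌈(n : ℝ) * (1 + R) / 2⌉₊ with hk
  have hkn : k ≤ n := Nat.ceil_le.2 (by nlinarith)
  have hk1 : (n : ℝ) * (1 + R) / 2 ≤ k := Nat.le_ceil _
  have hk2 : (k : ℝ) < (n : ℝ) * (1 + R) / 2 + 1 := Nat.ceil_lt_add_one (by positivity)
  have hnk : n ≤ 2 * k := by
    have : (n : ℝ) ≤ 2 * k := by nlinarith
    exact_mod_cast this
  set H : (Fin n → ZMod d × ZMod d) → ℝ := fun x => entD d (empDist x) with hH
  obtain ⟨C, hC, hsum⟩ := exists_dualContaining_sum_le hkn hnk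
    (fun x => (d : ℝ) ^ (-(n * H x))) fun x => by positivity
  refine ⟨C, hC, ?_⟩
  have htypes : ∑ x : Fin n → ZMod d × ZMod d, (d : ℝ) ^ (-(n * H x)) ≤
      ((n : ℝ) + 1) ^ d ^ 2 := by
    have h := sum_prod_empDist_le (α := ZMod d × ZMod d) hn1
    simpa only [prod_empDist_eq_rpow hn1, Fintype.card_prod, ZMod.card, ← sq] using h
  have hexp : (d : ℝ) ^ (2 * k) ≤ (d : ℝ) ^ (n * (R - 1)) * (d : ℝ) ^ 2 * (d : ℝ) ^ (2 * n) := by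
    rw [← Real.rpow_natCast, ← Real.rpow_natCast, ← Real.rpow_natCast, ← Real.rpow_add hd0,
      ← Real.rpow_add hd0]
    refine Real.rpow_le_rpow_of_exponent_le hd.le ?_
    push_cast
    linarith
  refine le_of_mul_le_mul_right (hsum.trans ?_) (pow_pos hd0 (2 * n))
  calc (d : ℝ) ^ (2 * k) * ∑ x : Fin n → ZMod d × ZMod d, (d : ℝ) ^ (-(n * H x))
      ≤ ((d : ℝ) ^ (n * (R - 1)) * (d : ℝ) ^ 2 * (d : ℝ) ^ (2 * n)) * ((n : ℝ) + 1) ^ d ^ 2 := by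
        gcongr
    _ = (d : ℝ) ^ (n * (R - 1)) * ((d : ℝ) ^ 2 * ((n : ℝ) + 1) ^ d ^ 2) * (d : ℝ) ^ (2 * n) := by
        ring
    _ ≤ (d : ℝ) ^ (n * (R - 1)) * (d : ℝ) ^ (δ * n) * (d : ℝ) ^ (2 * n) := by gcongr
    _ = (d : ℝ) ^ (n * (R - 1 + δ)) * (d : ℝ) ^ (2 * n) := by
        rw [← Real.rpow_add hd0]
        ring_nf

theorem expurgation_exponent_achievable (d : ℕ) [Fact d.Prime] (q : ℕ) (hq : q = d ^ 2)
    (W : ZMod d × ZMod d → ℝ) (hW0 : ∀ x, 0 ≤ W x) (hW1 : ∑ x, W x = 1)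
    (hBpos : ∀ x : ZMod d × ZMod d, 0 < ∑ e, Real.sqrt (W e * W (e - x)))
    (R : ℝ) (hR : R ∈ Set.Ico (0 : ℝ) 1) (ε : ℝ) (hε : 0 < ε) :
    ∃ n₀ : ℕ, ∀ n : ℕ, n₀ ≤ n →
      ∃ (C : AddSubgroup (Fin n → ZMod d × ZMod d)) (E : Finset (Fin n → ZMod d × ZMod d)),
        Nat.card C = q ^ (⌈(n : ℝ) * (1 + R) / 2⌉₊) ∧
        (∀ y : Fin n → ZMod d × ZMod d, (∀ x ∈ C, sympForm x y = 0) → y ∈ C) ∧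
        (∀ y : Fin n → ZMod d × ZMod d, ∃! e, e ∈ E ∧ y - e ∈ C) ∧
        (∀ e ∈ E, ∀ y : Fin n → ZMod d × ZMod d, y - e ∈ C →
          (∏ i, W (y i)) ≤ ∏ i, W (e i)) ∧
        (∑ e ∈ Finset.univ.filter (fun e : Fin n → ZMod d × ZMod d => e ∉ E),
            ∏ i, W (e i)) ≤
          (d : ℝ) ^ (-(n : ℝ) * (Ex d R W - ε)) := by
  subst hq
  have hd : (1 : ℝ) < d := one_lt_prime_cast
  have hd0 : (0 : ℝ) < d := by positivity
  obtain ⟨hR0, hR1⟩ := hR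
  obtain ⟨δ, hδ0, hδε, hEx⟩ := exists_slack_Ex W hR0 (half_pos hε)
  obtain ⟨n₀, hn₀⟩ := eventually_poly_le_rpow hd (d ^ 2) hδ0
  refine ⟨max n₀ 1, fun n hn => ?_⟩
  have hn1 : 0 < n := (le_max_right n₀ 1).trans hn
  have hn1' : (0 : ℝ) < n := by exact_mod_cast hn1
  set H : (Fin n → ZMod d × ZMod d) → ℝ := fun x => entD d (empDist x) with hH
  obtain ⟨C, hC, hspec⟩ := exists_dualContaining_entropy_sum_le hn1 hR0 hR1
    (hn₀ n ((le_max_left n₀ 1).trans hn))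
  obtain ⟨hCcard, hCdual⟩ := mem_dualContainingCodes.1 hC
  obtain ⟨E, hE, hEmax⟩ := exists_max_transversal C fun e => ∏ i, W (e i)
  refine ⟨C, E, hCcard, hCdual, hE, hEmax, ?_⟩
  have hent (x) (hx : x ∈ Finset.univ.filter fun x => x ∈ C ∧ x ≠ 0) : 1 - R - δ ≤ H x := by
    have h1 := (Finset.single_le_sum (f := fun x => (d : ℝ) ^ (-(n * H x)))
      (fun x _ => by positivity) hx).trans hspec
    have h2 := (Real.rpow_le_rpow_left_iff hd).1 h1
    refine le_of_mul_le_mul_left ?_ hn1'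
    linarith
  refine (sum_not_mem_transversal_le C (fun e => Finset.prod_nonneg fun i _ => hW0 _) hE
    hEmax).trans ?_
  calc ∑ x with x ∈ C ∧ x ≠ 0, ∑ e : Fin n → ZMod d × ZMod d,
        √((∏ i, W (e i)) * ∏ i, W ((e - x) i))
      ≤ ∑ x with x ∈ C ∧ x ≠ 0,
          (d : ℝ) ^ (-n * (Ex d R W - ε / 2 + R - 1)) * (d : ℝ) ^ (-(n * H x)) := by
        refine Finset.sum_le_sum fun x hx => ?_
        rw [sum_sqrt_prod_eq_rpow hn1 hW0 hBpos, ← Real.rpow_add hd0]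
        refine Real.rpow_le_rpow_of_exponent_le hd.le ?_
        have h := hEx (empDist x) (empDist_nonneg x) (sum_empDist hn1 x) (hent x hx)
        have h' := mul_le_mul_of_nonneg_left h hn1'.le
        simp only [hH]
        linarith
    _ ≤ (d : ℝ) ^ (-n * (Ex d R W - ε / 2 + R - 1)) * (d : ℝ) ^ (n * (R - 1 + δ)) := by
        rw [← Finset.mul_sum]
        gcongr
    _ ≤ (d : ℝ) ^ (-(n : ℝ) * (Ex d R W - ε)) := by
        rw [← Real.rpow_add hd0]
        refine Real.rpow_le_rpow_of_exponent_le hd.le ?_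
        nlinarith
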